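/- arXiv:0905.2215 — 3 statements merged into one kernel-verified Lean document; each statement's English description precedes it below -/
import Mathlib

section
/- Let U = U_q sl(2) at q = exp(iπ/p) be the 2p³-dimensional restricted quantum group with generators E, F, K (K = k²) and let A = ℂ_q[z,∂] ⊗ ℂ[λ]/(λ^{2p}−1) with z^p = ∂^p = 0, ∂z = (q−q⁻¹) + q⁻²z∂, λ central in A. Then the assignments E ▷ z^m = −q^m [m]_q z^{m+1}, K ▷ z^m = q^{2m} z^m, F ▷ z^m = [m]_q q^{1−m} z^{m−1}, E ▷ ∂^n = q^{1−n}[n]_q ∂^{n−1}, K ▷ ∂^n = q^{−2n}∂^n, F ▷ ∂^n = −q^n[n]_q ∂^{n+1}, E ▷ λ^n = q^{−n/2}[n/2]_q λ^n z, K ▷ λ^n = q^{−n}λ^n, F ▷ λ^n = −q^{n/2}[n/2]_q λ^n ∂ extend to a well-defined action of U on A making A a U-module algebra. -/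
/-!
STATEMENT 13: For `q = exp(iπ/p)`, the stated action of the restricted quantum group
`U_q sl(2)` (generators `E, F, K`) on `A = ℂ_q[z,∂] ⊗ ℂ[λ]/(λ^{2p}−1)` extends to a
well-defined action making `A` a `U_q sl(2)`-module algebra.
-/

noncomputable section

/-- `[x]_q` for integer `x`. -/
def qint (q : ℂ) (n : ℕ) : ℂ := (q ^ n - q⁻¹ ^ n) / (q - q⁻¹)

/-- `[n/2]_q`, computed with `q2 = q^{1/2}`. -/
def qhint (q q2 : ℂ) (n : ℕ) : ℂ := (q2 ^ n - (q2 ^ n)⁻¹) / (q - q⁻¹)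

/-- Relations of `U_q sl(2)`: `E = X 0`, `F = X 1`, `K = X 2`. -/
inductive uRel (p : ℕ) (q : ℂ) : FreeAlgebra ℂ (Fin 3) → FreeAlgebra ℂ (Fin 3) → Prop
  | KE : uRel p q (FreeAlgebra.ι ℂ (2 : Fin 3) * FreeAlgebra.ι ℂ (0 : Fin 3))
      ((q ^ 2) • (FreeAlgebra.ι ℂ (0 : Fin 3) * FreeAlgebra.ι ℂ (2 : Fin 3)))
  | KF : uRel p q (FreeAlgebra.ι ℂ (2 : Fin 3) * FreeAlgebra.ι ℂ (1 : Fin 3))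
      (((q ^ 2)⁻¹) • (FreeAlgebra.ι ℂ (1 : Fin 3) * FreeAlgebra.ι ℂ (2 : Fin 3)))
  | EF : uRel p q (FreeAlgebra.ι ℂ (0 : Fin 3) * FreeAlgebra.ι ℂ (1 : Fin 3))
      (FreeAlgebra.ι ℂ (1 : Fin 3) * FreeAlgebra.ι ℂ (0 : Fin 3)
        + ((q - q⁻¹)⁻¹) • (FreeAlgebra.ι ℂ (2 : Fin 3)
            - (FreeAlgebra.ι ℂ (2 : Fin 3)) ^ (2 * p - 1)))
  | Enil : uRel p q ((FreeAlgebra.ι ℂ (0 : Fin 3)) ^ p) 0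
  | Fnil : uRel p q ((FreeAlgebra.ι ℂ (1 : Fin 3)) ^ p) 0
  | Kord : uRel p q ((FreeAlgebra.ι ℂ (2 : Fin 3)) ^ (2 * p)) 1

/-- The restricted quantum group `U_q sl(2)`. -/
def Uq (p : ℕ) (q : ℂ) : Type := RingQuot (uRel p q)

instance (p : ℕ) (q : ℂ) : Ring (Uq p q) := inferInstanceAs (Ring (RingQuot (uRel p q)))
instance (p : ℕ) (q : ℂ) : Algebra ℂ (Uq p q) :=
  inferInstanceAs (Algebra ℂ (RingQuot (uRel p q)))

def Eu (p : ℕ) (q : ℂ) : Uq p q := RingQuot.mkAlgHom ℂ (uRel p q) (FreeAlgebra.ι ℂ 0)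
def Fu (p : ℕ) (q : ℂ) : Uq p q := RingQuot.mkAlgHom ℂ (uRel p q) (FreeAlgebra.ι ℂ 1)
def Ku (p : ℕ) (q : ℂ) : Uq p q := RingQuot.mkAlgHom ℂ (uRel p q) (FreeAlgebra.ι ℂ 2)

/-- Relations of `A = ℂ_q[z,∂] ⊗ ℂ[λ]/(λ^{2p}−1)`: `z = X 0`, `∂ = X 1`, `λ = X 2`. -/
inductive aRel (p : ℕ) (q : ℂ) : FreeAlgebra ℂ (Fin 3) → FreeAlgebra ℂ (Fin 3) → Prop
  | znil : aRel p q ((FreeAlgebra.ι ℂ (0 : Fin 3)) ^ p) 0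
  | dnil : aRel p q ((FreeAlgebra.ι ℂ (1 : Fin 3)) ^ p) 0
  | dz : aRel p q (FreeAlgebra.ι ℂ (1 : Fin 3) * FreeAlgebra.ι ℂ (0 : Fin 3))
      ((q - q⁻¹) • (1 : FreeAlgebra ℂ (Fin 3))
        + ((q ^ 2)⁻¹) • (FreeAlgebra.ι ℂ (0 : Fin 3) * FreeAlgebra.ι ℂ (1 : Fin 3)))
  | lz : aRel p q (FreeAlgebra.ι ℂ (2 : Fin 3) * FreeAlgebra.ι ℂ (0 : Fin 3))
      (FreeAlgebra.ι ℂ (0 : Fin 3) * FreeAlgebra.ι ℂ (2 : Fin 3))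
  | ld : aRel p q (FreeAlgebra.ι ℂ (2 : Fin 3) * FreeAlgebra.ι ℂ (1 : Fin 3))
      (FreeAlgebra.ι ℂ (1 : Fin 3) * FreeAlgebra.ι ℂ (2 : Fin 3))
  | lord : aRel p q ((FreeAlgebra.ι ℂ (2 : Fin 3)) ^ (2 * p)) 1

/-- The algebra `A = ℂ_q[z,∂] ⊗ ℂ[λ]/(λ^{2p}−1)`. -/
def Aq (p : ℕ) (q : ℂ) : Type := RingQuot (aRel p q)

instance (p : ℕ) (q : ℂ) : Ring (Aq p q) := inferInstanceAs (Ring (RingQuot (aRel p q)))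
instance (p : ℕ) (q : ℂ) : Algebra ℂ (Aq p q) :=
  inferInstanceAs (Algebra ℂ (RingQuot (aRel p q)))

def Za (p : ℕ) (q : ℂ) : Aq p q := RingQuot.mkAlgHom ℂ (aRel p q) (FreeAlgebra.ι ℂ 0)
def Da (p : ℕ) (q : ℂ) : Aq p q := RingQuot.mkAlgHom ℂ (aRel p q) (FreeAlgebra.ι ℂ 1)
def La (p : ℕ) (q : ℂ) : Aq p q := RingQuot.mkAlgHom ℂ (aRel p q) (FreeAlgebra.ι ℂ 2)

/-! ### Nilpotency of sums of `ω`-commuting nilpotent elements -/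

section QCommuting

variable {k R : Type*} [Field k] [Ring R] [Algebra k R]

/-- The Gaussian number `1 + ω + ⋯ + ω ^ (n - 1)`. -/
def gaussNum (ω : k) (n : ℕ) : k := ∑ j ∈ Finset.range n, ω ^ j

/-- The Gaussian factorial. -/
def gaussFact (ω : k) (n : ℕ) : k := ∏ i ∈ Finset.range n, gaussNum ω (i + 1)

theorem gaussNum_add (ω : k) (i j : ℕ) :
    gaussNum ω (i + j) = gaussNum ω i + ω ^ i * gaussNum ω j := by
  simp [gaussNum, Finset.sum_range_add, Finset.mul_sum, pow_add]

theorem gaussFact_succ (ω : k) (n : ℕ) :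
    gaussFact ω (n + 1) = gaussFact ω n * gaussNum ω (n + 1) :=
  Finset.prod_range_succ _ _

theorem gaussNum_ne_zero {ω : k} {p n : ℕ} (h : IsPrimitiveRoot ω p) (hn : 0 < n)
    (hnp : n < p) : gaussNum ω n ≠ 0 := by
  intro h0
  have h1 := geom_sum_mul ω n
  rw [show ∑ i ∈ Finset.range n, ω ^ i = 0 from h0, zero_mul] at h1
  exact h.pow_ne_one_of_pos_of_lt hn.ne' hnp (sub_eq_zero.mp h1.symm)

theorem gaussFact_eq_zero {ω : k} {p : ℕ} (h : IsPrimitiveRoot ω p) (hp : 1 < p) :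
    gaussFact ω p = 0 := by
  obtain ⟨m, rfl⟩ : ∃ m, p = m + 1 := ⟨p - 1, by omega⟩
  rw [gaussFact_succ, gaussNum, h.geom_sum_eq_zero hp, mul_zero]

/-- The `ω`-divided powers of an element, with junk value `0` where the factorial vanishes. -/
def gaussDivPow (ω : k) (X : R) (n : ℕ) : R := (gaussFact ω n)⁻¹ • X ^ n

theorem mul_gaussDivPow {ω : k} {p : ℕ} (h : IsPrimitiveRoot ω p) {X : R} (hX : X ^ p = 0)
    (n : ℕ) : X * gaussDivPow ω X n = gaussNum ω (n + 1) • gaussDivPow ω X (n + 1) := by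
  rw [gaussDivPow, gaussDivPow, mul_smul_comm, ← pow_succ', smul_smul]
  rcases lt_or_ge (n + 1) p with hn | hn
  · rw [gaussFact_succ, mul_inv, mul_left_comm,
      mul_inv_cancel₀ (gaussNum_ne_zero h n.succ_pos hn), mul_one]
  · rw [pow_eq_zero_of_le hn hX, smul_zero, smul_zero]

theorem mul_pow_of_qcomm {ω : k} {X Y : R} (hXY : Y * X = ω • (X * Y)) (n : ℕ) :
    Y * X ^ n = ω ^ n • (X ^ n * Y) := by
  induction n with
  | zero => simp
  | succ n ih =>
    rw [pow_succ, ← mul_assoc, ih, smul_mul_assoc, mul_assoc, hXY, mul_smul_comm, smul_smul,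
      pow_succ, mul_assoc]

theorem add_pow_eq_gaussFact_smul {ω : k} {p : ℕ} (h : IsPrimitiveRoot ω p) {X Y : R}
    (hXY : Y * X = ω • (X * Y)) (hX : X ^ p = 0) (hY : Y ^ p = 0) (n : ℕ) :
    (X + Y) ^ n = gaussFact ω n •
      ∑ x ∈ Finset.HasAntidiagonal.antidiagonal n, gaussDivPow ω X x.1 * gaussDivPow ω Y x.2 := by
  induction n with
  | zero => simp [gaussFact, gaussDivPow]
  | succ n ih =>
    have hcomm (i : ℕ) : Y * gaussDivPow ω X i = ω ^ i • (gaussDivPow ω X i * Y) := by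
      simp only [gaussDivPow, mul_smul_comm, smul_mul_assoc, mul_pow_of_qcomm hXY, smul_smul,
        mul_comm]
    have key : gaussNum ω (n + 1) • ∑ x ∈ Finset.HasAntidiagonal.antidiagonal (n + 1),
          gaussDivPow ω X x.1 * gaussDivPow ω Y x.2
        = ∑ x ∈ Finset.HasAntidiagonal.antidiagonal (n + 1),
            gaussNum ω x.1 • (gaussDivPow ω X x.1 * gaussDivPow ω Y x.2)
          + ∑ x ∈ Finset.HasAntidiagonal.antidiagonal (n + 1),
            (ω ^ x.1 * gaussNum ω x.2) • (gaussDivPow ω X x.1 * gaussDivPow ω Y x.2) := by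
      rw [← Finset.sum_add_distrib, Finset.smul_sum]
      refine Finset.sum_congr rfl fun x hx => ?_
      rw [← add_smul, ← gaussNum_add, Finset.HasAntidiagonal.mem_antidiagonal.mp hx]
    rw [pow_succ', ih, mul_smul_comm, gaussFact_succ, mul_smul, key,
      Finset.Nat.sum_antidiagonal_succ, Finset.Nat.sum_antidiagonal_succ']
    simp only [gaussNum, Finset.range_zero, Finset.sum_empty, zero_smul, mul_zero, zero_add]
    rw [← Finset.sum_add_distrib, Finset.mul_sum]
    congr 1
    refine Finset.sum_congr rfl fun x _ => ?_
    rw [add_mul, ← mul_assoc, mul_gaussDivPow h hX, ← mul_assoc, hcomm, smul_mul_assoc,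
      smul_mul_assoc, mul_assoc _ Y, mul_gaussDivPow h hY, mul_smul_comm, smul_smul]
    rfl

theorem add_pow_eq_zero_of_qcomm {ω : k} {p : ℕ} (h : IsPrimitiveRoot ω p) (hp : 1 < p)
    {X Y : R} (hXY : Y * X = ω • (X * Y)) (hX : X ^ p = 0) (hY : Y ^ p = 0) :
    (X + Y) ^ p = 0 := by
  rw [add_pow_eq_gaussFact_smul h hXY hX hY, gaussFact_eq_zero h hp, zero_smul]

theorem sub_pow_eq_zero_of_qcomm {ω : k} {p : ℕ} (h : IsPrimitiveRoot ω p) (hp : 1 < p)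
    {X Y : R} (hXY : Y * X = ω • (X * Y)) (hX : X ^ p = 0) (hY : Y ^ p = 0) :
    (X - Y) ^ p = 0 := by
  rw [sub_eq_add_neg]
  refine add_pow_eq_zero_of_qcomm h hp ?_ hX ?_
  · rw [neg_mul, hXY, mul_neg, smul_neg]
  · rw [neg_pow, hY, mul_zero]

theorem mul_pow_eq_smul_of_qcomm {ω : k} {X Y : R} (hXY : Y * X = ω • (X * Y)) (n : ℕ) :
    ∃ s : k, (X * Y) ^ n = s • (X ^ n * Y ^ n) := by
  induction n with
  | zero => exact ⟨1, by simp⟩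
  | succ n ih =>
    obtain ⟨s, hs⟩ := ih
    refine ⟨ω ^ n * s, ?_⟩
    rw [pow_succ', hs, mul_smul_comm, mul_assoc X Y, ← mul_assoc Y, mul_pow_of_qcomm hXY,
      smul_mul_assoc, mul_smul_comm, smul_smul, pow_succ' X, pow_succ' Y, mul_comm s]
    simp only [mul_assoc]

end QCommuting

/-! ### Inner skew derivations -/

section InnerSkew

variable {A : Type*} [Ring A] [Algebra ℂ A]

/-- The inner skew derivation `a ↦ c (a z - z σ(a))`. -/
def skewE (c : ℂ) (z : A) (σ : A →ₐ[ℂ] A) : Module.End ℂ A :=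
  c • (LinearMap.mulRight ℂ z - LinearMap.mulLeft ℂ z * σ.toLinearMap)

/-- The inner skew derivation `a ↦ c (d a - τ(a) d)`. -/
def skewF (c : ℂ) (d : A) (τ : A →ₐ[ℂ] A) : Module.End ℂ A :=
  c • (LinearMap.mulLeft ℂ d - LinearMap.mulRight ℂ d * τ.toLinearMap)

theorem skewE_apply (c : ℂ) (z : A) (σ : A →ₐ[ℂ] A) (a : A) :
    skewE c z σ a = c • (a * z - z * σ a) := rfl

theorem skewF_apply (c : ℂ) (d : A) (τ : A →ₐ[ℂ] A) (a : A) :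
    skewF c d τ a = c • (d * a - τ a * d) := rfl

theorem skewE_mul (c : ℂ) (z : A) (σ : A →ₐ[ℂ] A) (a b : A) :
    skewE c z σ (a * b) = a * skewE c z σ b + skewE c z σ a * σ b := by
  simp only [skewE_apply, map_mul, mul_smul_comm, smul_mul_assoc, ← smul_add]
  congr 1
  noncomm_ring

theorem skewF_mul (c : ℂ) (d : A) (τ : A →ₐ[ℂ] A) (a b : A) :
    skewF c d τ (a * b) = τ a * skewF c d τ b + skewF c d τ a * b := by
  simp only [skewF_apply, map_mul, mul_smul_comm, smul_mul_assoc, ← smul_add]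
  congr 1
  noncomm_ring

theorem skewE_pow_eq_zero (c : ℂ) {z : A} {σ : A →ₐ[ℂ] A} {ω : ℂ} {p : ℕ}
    (h : IsPrimitiveRoot ω p) (hp : 1 < p) (hz : z ^ p = 0) (hσ : σ z = ω • z) :
    skewE c z σ ^ p = 0 := by
  have h1 : σ.toLinearMap * LinearMap.mulLeft ℂ z
      = ω • (LinearMap.mulLeft ℂ z * σ.toLinearMap) := by
    ext a; simp [hσ]
  rw [skewE, smul_pow, sub_pow_eq_zero_of_qcomm h hp, smul_zero]
  · ext a; simp [hσ, mul_assoc]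
  · rw [LinearMap.pow_mulRight, hz, LinearMap.mulRight_zero_eq_zero]
  · obtain ⟨s, hs⟩ := mul_pow_eq_smul_of_qcomm h1 p
    rw [hs, LinearMap.pow_mulLeft, hz, LinearMap.mulLeft_zero_eq_zero]
    simp

theorem skewF_pow_eq_zero (c : ℂ) {d : A} {τ : A →ₐ[ℂ] A} {ω : ℂ} {p : ℕ}
    (h : IsPrimitiveRoot ω p) (hp : 1 < p) (hd : d ^ p = 0) (hτ : τ d = ω • d) :
    skewF c d τ ^ p = 0 := by
  have h1 : τ.toLinearMap * LinearMap.mulRight ℂ d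
      = ω • (LinearMap.mulRight ℂ d * τ.toLinearMap) := by
    ext a; simp [hτ]
  rw [skewF, smul_pow, sub_pow_eq_zero_of_qcomm h hp, smul_zero]
  · ext a; simp [hτ, mul_assoc]
  · rw [LinearMap.pow_mulLeft, hd, LinearMap.mulLeft_zero_eq_zero]
  · obtain ⟨s, hs⟩ := mul_pow_eq_smul_of_qcomm h1 p
    rw [hs, LinearMap.pow_mulRight, hd, LinearMap.mulRight_zero_eq_zero]
    simp

theorem mul_skewE (c : ℂ) {z : A} {σ : A →ₐ[ℂ] A} {ω : ℂ} (hσ : σ z = ω • z) :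
    σ.toLinearMap * skewE c z σ = ω • (skewE c z σ * σ.toLinearMap) := by
  ext a
  simp [skewE_apply, hσ, smul_sub, smul_smul, mul_comm]

theorem mul_skewF (c : ℂ) {d : A} {σ τ : A →ₐ[ℂ] A} {ω : ℂ} (hσ : σ d = ω • d)
    (hστ : ∀ a, σ (τ a) = a) (hτσ : ∀ a, τ (σ a) = a) :
    σ.toLinearMap * skewF c d τ = ω • (skewF c d τ * σ.toLinearMap) := by
  ext a
  simp [skewF_apply, hσ, hστ, hτσ, smul_sub, smul_smul, mul_comm]

theorem skewE_mul_skewF {b ω : ℂ} (hω : ω ≠ 0) (hb : b ≠ 0) {z d : A} {σ τ : A →ₐ[ℂ] A}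
    (hdz : d * z = b • (1 : A) + ω⁻¹ • (z * d))
    (hσd : σ d = ω⁻¹ • d) (hτz : τ z = ω⁻¹ • z)
    (hστ : ∀ a, σ (τ a) = a) (hτσ : ∀ a, τ (σ a) = a) :
    skewE b⁻¹ z σ * skewF b⁻¹ d τ
      = skewF b⁻¹ d τ * skewE b⁻¹ z σ + b⁻¹ • (σ.toLinearMap - τ.toLinearMap) := by
  ext a
  have h1 : τ a * d * z = b • τ a + ω⁻¹ • (τ a * z * d) := by
    rw [mul_assoc, hdz]; simp [mul_add, mul_assoc]
  have h2 : d * (z * σ a) = b • σ a + ω⁻¹ • (z * d * σ a) := by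
    rw [← mul_assoc, hdz]; simp [add_mul, mul_assoc]
  simp only [Module.End.mul_apply, LinearMap.add_apply, LinearMap.smul_apply,
    LinearMap.sub_apply, AlgHom.toLinearMap_apply, skewE_apply, skewF_apply, map_smul, map_sub,
    map_mul, hσd, hτz, hστ, hτσ, smul_sub, mul_smul_comm, smul_mul_assoc,
    h1, h2, smul_add]
  simp only [mul_assoc]
  match_scalars <;> field_simp
  ring

theorem mul_pow_of_weyl {b w : ℂ} {z d : A} (h : d * z = b • (1 : A) + w • (z * d)) (n : ℕ) :
    d * z ^ (n + 1) = (b * gaussNum w (n + 1)) • z ^ n + w ^ (n + 1) • (z ^ (n + 1) * d) := by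
  induction n with
  | zero => simp [gaussNum, h]
  | succ n ih =>
    rw [pow_succ z (n + 1), ← mul_assoc, ih, add_mul, smul_mul_assoc, smul_mul_assoc,
      ← pow_succ, mul_assoc _ d, h, gaussNum_add w (n + 1) 1]
    simp only [mul_add, mul_smul_comm, mul_one, ← mul_assoc, smul_add, smul_smul]
    simp only [gaussNum, Finset.sum_range_one, pow_zero]
    module

theorem pow_mul_of_weyl {b w : ℂ} {z d : A} (h : d * z = b • (1 : A) + w • (z * d)) (n : ℕ) :
    d ^ (n + 1) * z = (b * gaussNum w (n + 1)) • d ^ n + w ^ (n + 1) • (z * d ^ (n + 1)) := by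
  induction n with
  | zero => simp [gaussNum, h]
  | succ n ih =>
    rw [pow_succ' d (n + 1), mul_assoc, ih, mul_add, mul_smul_comm, mul_smul_comm,
      ← pow_succ', ← mul_assoc d z, h, gaussNum_add w (n + 1) 1]
    simp only [add_mul, smul_mul_assoc, one_mul, mul_assoc, smul_add, smul_smul]
    simp only [gaussNum, Finset.sum_range_one, pow_zero]
    module

end InnerSkew

/-! ### The presented algebras -/

theorem Za_pow (p : ℕ) (q : ℂ) : Za p q ^ p = 0 := by
  have := RingQuot.mkAlgHom_rel ℂ (aRel.znil (p := p) (q := q))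
  rwa [map_pow, map_zero] at this

theorem Da_pow (p : ℕ) (q : ℂ) : Da p q ^ p = 0 := by
  have := RingQuot.mkAlgHom_rel ℂ (aRel.dnil (p := p) (q := q))
  rwa [map_pow, map_zero] at this

theorem La_pow (p : ℕ) (q : ℂ) : La p q ^ (2 * p) = 1 := by
  have := RingQuot.mkAlgHom_rel ℂ (aRel.lord (p := p) (q := q))
  rwa [map_pow, map_one] at this

theorem Da_mul_Za (p : ℕ) (q : ℂ) :
    Da p q * Za p q = (q - q⁻¹) • (1 : Aq p q) + (q ^ 2)⁻¹ • (Za p q * Da p q) := by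
  have := RingQuot.mkAlgHom_rel ℂ (aRel.dz (p := p) (q := q))
  rwa [map_add, map_smul, map_smul, map_mul, map_mul, map_one] at this

theorem La_mul_Za (p : ℕ) (q : ℂ) : La p q * Za p q = Za p q * La p q := by
  have := RingQuot.mkAlgHom_rel ℂ (aRel.lz (p := p) (q := q))
  rwa [map_mul, map_mul] at this

theorem La_mul_Da (p : ℕ) (q : ℂ) : La p q * Da p q = Da p q * La p q := by
  have := RingQuot.mkAlgHom_rel ℂ (aRel.ld (p := p) (q := q))
  rwa [map_mul, map_mul] at this

theorem Aq.algHom_ext {p : ℕ} {q : ℂ} {B : Type*} [Ring B] [Algebra ℂ B]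
    {f g : Aq p q →ₐ[ℂ] B} (hz : f (Za p q) = g (Za p q)) (hd : f (Da p q) = g (Da p q))
    (hl : f (La p q) = g (La p q)) : f = g := by
  refine RingQuot.ringQuot_ext' ℂ f g (FreeAlgebra.hom_ext (funext fun i => ?_))
  fin_cases i
  exacts [hz, hd, hl]

theorem Aq.exists_lift (p : ℕ) (q : ℂ) {B : Type*} [Ring B] [Algebra ℂ B] (z d l : B)
    (hz : z ^ p = 0) (hd : d ^ p = 0)
    (hdz : d * z = (q - q⁻¹) • (1 : B) + (q ^ 2)⁻¹ • (z * d))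
    (hlz : l * z = z * l) (hld : l * d = d * l) (hl : l ^ (2 * p) = 1) :
    ∃ f : Aq p q →ₐ[ℂ] B, f (Za p q) = z ∧ f (Da p q) = d ∧ f (La p q) = l := by
  have h : ∀ ⦃x y⦄, aRel p q x y →
      FreeAlgebra.lift ℂ ![z, d, l] x = FreeAlgebra.lift ℂ ![z, d, l] y := by
    rintro x y (_ | _ | _ | _ | _ | _) <;> simp [hz, hd, hdz, hlz, hld, hl]
  refine ⟨RingQuot.liftAlgHom ℂ ⟨FreeAlgebra.lift ℂ ![z, d, l], h⟩, ?_, ?_, ?_⟩ <;>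
  · refine (RingQuot.liftAlgHom_mkAlgHom_apply ℂ _ h _).trans ?_
    simp

theorem Uq.exists_lift (p : ℕ) (q : ℂ) {B : Type*} [Ring B] [Algebra ℂ B] (e f k : B)
    (hke : k * e = q ^ 2 • (e * k)) (hkf : k * f = (q ^ 2)⁻¹ • (f * k))
    (hef : e * f = f * e + (q - q⁻¹)⁻¹ • (k - k ^ (2 * p - 1)))
    (he : e ^ p = 0) (hf : f ^ p = 0) (hk : k ^ (2 * p) = 1) :
    ∃ φ : Uq p q →ₐ[ℂ] B, φ (Eu p q) = e ∧ φ (Fu p q) = f ∧ φ (Ku p q) = k := by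
  have h : ∀ ⦃x y⦄, uRel p q x y →
      FreeAlgebra.lift ℂ ![e, f, k] x = FreeAlgebra.lift ℂ ![e, f, k] y := by
    rintro x y (_ | _ | _ | _ | _ | _) <;> simp [hke, hkf, hef, he, hf, hk]
  refine ⟨RingQuot.liftAlgHom ℂ ⟨FreeAlgebra.lift ℂ ![e, f, k], h⟩, ?_, ?_, ?_⟩ <;>
  · refine (RingQuot.liftAlgHom_mkAlgHom_apply ℂ _ h _).trans ?_
    simp

/-- The scaling automorphism by which `K` acts. -/
theorem Aq.exists_scale (p : ℕ) {q : ℂ} (hq : q ≠ 0) (hqp : q ^ (2 * p) = 1) :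
    ∃ σ : Aq p q →ₐ[ℂ] Aq p q, σ (Za p q) = q ^ 2 • Za p q ∧
      σ (Da p q) = (q ^ 2)⁻¹ • Da p q ∧ σ (La p q) = q⁻¹ • La p q := by
  apply Aq.exists_lift
  · rw [smul_pow, Za_pow, smul_zero]
  · rw [smul_pow, Da_pow, smul_zero]
  · rw [smul_mul_smul_comm, smul_mul_smul_comm, Da_mul_Za, mul_comm,
      mul_inv_cancel₀ (pow_ne_zero 2 hq), one_smul, one_smul]
  · rw [smul_mul_smul_comm, smul_mul_smul_comm, La_mul_Za, mul_comm]
  · rw [smul_mul_smul_comm, smul_mul_smul_comm, La_mul_Da, mul_comm]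
  · rw [smul_pow, La_pow, inv_pow, hqp, inv_one, one_smul]

theorem gaussNum_inv_sq {q : ℂ} (hq : q ≠ 0) (hb : q - q⁻¹ ≠ 0) (n : ℕ) :
    gaussNum (q ^ 2)⁻¹ n = qint q n * q ^ ((1 : ℤ) - n) := by
  have h1 : (q ^ 2)⁻¹ - 1 ≠ 0 := by
    intro h
    apply hb
    have : q - q⁻¹ = -q * ((q ^ 2)⁻¹ - 1) := by field_simp; ring
    rw [this, h, mul_zero]
  have h2 : gaussNum (q ^ 2)⁻¹ n * ((q ^ 2)⁻¹ - 1) = (q ^ 2)⁻¹ ^ n - 1 := geom_sum_mul _ _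
  apply mul_right_cancel₀ h1
  rw [h2, qint, zpow_sub₀ hq, zpow_one, zpow_natCast, inv_pow, inv_pow, ← pow_mul, mul_comm 2 n,
    pow_mul]
  have h3 := pow_ne_zero n hq
  generalize q ^ n = x at h3
  have h4 : q ^ 2 - 1 ≠ 0 := by
    intro h
    apply hb
    have : q - q⁻¹ = (q ^ 2 - 1) * q⁻¹ := by field_simp
    rw [this, h, zero_mul]
  field_simp
  ring

theorem uqsl2_module_algebra_structure
    (p : ℕ) (hp : 2 ≤ p)
    (q q2 : ℂ)
    (hq : q = Complex.exp (Real.pi * Complex.I / p))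
    (hq2 : q2 = Complex.exp (Real.pi * Complex.I / (2 * p))) :
    ∃ ρ : Uq p q →ₐ[ℂ] Module.End ℂ (Aq p q),
      -- action on powers of z
      (∀ m : ℕ, ρ (Eu p q) (Za p q ^ m) = (-(q ^ m) * qint q m) • Za p q ^ (m + 1)) ∧
      (∀ m : ℕ, ρ (Ku p q) (Za p q ^ m) = (q ^ (2 * m)) • Za p q ^ m) ∧
      (∀ m : ℕ, ρ (Fu p q) (Za p q ^ m)
          = (qint q m * q ^ ((1 : ℤ) - m)) • Za p q ^ (m - 1)) ∧
      -- action on powers of ∂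
      (∀ n : ℕ, ρ (Eu p q) (Da p q ^ n)
          = (q ^ ((1 : ℤ) - n) * qint q n) • Da p q ^ (n - 1)) ∧
      (∀ n : ℕ, ρ (Ku p q) (Da p q ^ n) = (q ^ (-2 * (n : ℤ))) • Da p q ^ n) ∧
      (∀ n : ℕ, ρ (Fu p q) (Da p q ^ n) = (-(q ^ n) * qint q n) • Da p q ^ (n + 1)) ∧
      -- action on powers of λ
      (∀ n : ℕ, ρ (Eu p q) (La p q ^ n)
          = (q2 ^ (-(n : ℤ)) * qhint q q2 n) • (La p q ^ n * Za p q)) ∧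
      (∀ n : ℕ, ρ (Ku p q) (La p q ^ n) = (q ^ (-(n : ℤ))) • La p q ^ n) ∧
      (∀ n : ℕ, ρ (Fu p q) (La p q ^ n)
          = (-(q2 ^ n) * qhint q q2 n) • (La p q ^ n * Da p q)) ∧
      -- the module algebra property, via `Δ(E) = 1⊗E + E⊗K`, `Δ(K) = K⊗K`,
      -- `Δ(F) = K⁻¹⊗F + F⊗1` (`K⁻¹ = K^{2p−1}`), and `h ▷ 1 = ε(h)1`
      (∀ a b : Aq p q,
        ρ (Eu p q) (a * b) = a * ρ (Eu p q) b + ρ (Eu p q) a * ρ (Ku p q) b) ∧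
      (∀ a b : Aq p q,
        ρ (Fu p q) (a * b) = ρ (Ku p q ^ (2 * p - 1)) a * ρ (Fu p q) b + ρ (Fu p q) a * b) ∧
      (∀ a b : Aq p q, ρ (Ku p q) (a * b) = ρ (Ku p q) a * ρ (Ku p q) b) ∧
      ρ (Eu p q) (1 : Aq p q) = 0 ∧
      ρ (Fu p q) (1 : Aq p q) = 0 ∧
      ρ (Ku p q) (1 : Aq p q) = 1 := by
  have hp0 : p ≠ 0 := by omega
  have hprim : IsPrimitiveRoot q (2 * p) := by
    have := Complex.isPrimitiveRoot_exp (2 * p) (by omega)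
    rwa [show 2 * (Real.pi : ℂ) * Complex.I / ((2 * p : ℕ) : ℂ) = Real.pi * Complex.I / p by
      push_cast; field_simp, ← hq] at this
  have hprim2 : IsPrimitiveRoot (q ^ 2) p := hprim.pow (by omega) rfl
  have hq0 : q ≠ 0 := hprim.ne_zero (by omega)
  have hb : q - q⁻¹ ≠ 0 := by
    intro h
    apply hprim2.ne_one (by omega)
    rw [sq]
    nth_rewrite 2 [sub_eq_zero.mp h]
    exact mul_inv_cancel₀ hq0
  have hq20 : q2 ≠ 0 := hq2 ▸ Complex.exp_ne_zero _
  have hqq : q = q2 ^ 2 := by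
    rw [hq, hq2, ← Complex.exp_nat_mul]
    congr 1
    push_cast
    field_simp
  obtain ⟨σ, hσz, hσd, hσl⟩ := Aq.exists_scale p hq0 hprim.pow_eq_one
  have hσpow (n : ℕ) (u : ℂ) (a : Aq p q) (h : σ a = u • a) : (σ ^ n) a = u ^ n • a := by
    induction n with
    | zero => simp
    | succ n ih => rw [pow_succ, AlgHom.mul_apply, h, map_smul, ih, smul_smul, pow_succ']
  have hσ1 : σ ^ (2 * p) = 1 := by
    apply Aq.algHom_ext <;> rw [AlgHom.one_apply]
    · rw [hσpow _ _ _ hσz, ← pow_mul, mul_comm, pow_mul, hprim.pow_eq_one, one_pow, one_smul]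
    · rw [hσpow _ _ _ hσd, inv_pow, ← pow_mul, mul_comm, pow_mul, hprim.pow_eq_one, one_pow,
        inv_one, one_smul]
    · rw [hσpow _ _ _ hσl, inv_pow, hprim.pow_eq_one, inv_one, one_smul]
  obtain ⟨τ, hτ⟩ : ∃ τ, τ = σ ^ (2 * p - 1) := ⟨_, rfl⟩
  have hστ (a) : σ (τ a) = a := by
    rw [hτ, ← AlgHom.mul_apply, ← pow_succ', Nat.sub_add_cancel (by omega), hσ1,
      AlgHom.one_apply]
  have hτσ (a) : τ (σ a) = a := by
    rw [hτ, ← AlgHom.mul_apply, ← pow_succ, Nat.sub_add_cancel (by omega), hσ1,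
      AlgHom.one_apply]
  have hτ_of (u : ℂ) (hu : u ≠ 0) (a) (h : σ a = u • a) : τ a = u⁻¹ • a := by
    rw [eq_inv_smul_iff₀ hu, ← map_smul, ← h, hτσ]
  have hq2ne : q ^ 2 ≠ 0 := pow_ne_zero 2 hq0
  have hτz := hτ_of _ hq2ne _ hσz
  have hτd := hτ_of _ (inv_ne_zero hq2ne) _ hσd
  have hτl := hτ_of _ (inv_ne_zero hq0) _ hσl
  rw [inv_inv] at hτd hτl
  have hlin (n : ℕ) : σ.toLinearMap ^ n = (σ ^ n).toLinearMap := by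
    induction n with
    | zero => rfl
    | succ n ih => rw [pow_succ, ih, pow_succ]; rfl
  obtain ⟨ρ, hE, hF, hK⟩ := Uq.exists_lift p q (skewE (q - q⁻¹)⁻¹ (Za p q) σ)
    (skewF (q - q⁻¹)⁻¹ (Da p q) τ) σ.toLinearMap (mul_skewE _ hσz) (mul_skewF _ hσd hστ hτσ)
    (by
      rw [hlin, ← hτ]
      exact skewE_mul_skewF hq2ne hb (Da_mul_Za p q) hσd hτz hστ hτσ)
    (skewE_pow_eq_zero _ hprim2 (by omega) (Za_pow p q) hσz)
    (skewF_pow_eq_zero _ hprim2 (by omega) (Da_pow p q) hτd)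
    (by rw [hlin, hσ1]; rfl)
  have hlz (n : ℕ) : Za p q * La p q ^ n = La p q ^ n * Za p q :=
    ((show Commute (La p q) (Za p q) from La_mul_Za p q).pow_left n).symm
  have hld (n : ℕ) : Da p q * La p q ^ n = La p q ^ n * Da p q :=
    ((show Commute (La p q) (Da p q) from La_mul_Da p q).pow_left n).symm
  refine ⟨ρ, fun m => ?_, fun m => ?_, fun m => ?_, fun n => ?_, fun n => ?_, fun n => ?_,
    fun n => ?_, fun n => ?_, fun n => ?_, fun a b => ?_, fun a b => ?_, fun a b => ?_,
    ?_, ?_, ?_⟩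
  · rw [hE, skewE_apply, map_pow, hσz, smul_pow, mul_smul_comm, ← pow_succ, ← pow_succ']
    rw [show Za p q ^ (m + 1) - (q ^ 2) ^ m • Za p q ^ (m + 1)
      = (1 - (q ^ 2) ^ m) • Za p q ^ (m + 1) by module, smul_smul, qint]
    congr 1
    have := pow_ne_zero m hq0
    rw [← pow_mul, mul_comm 2 m, pow_mul, inv_pow]
    generalize q ^ m = x at *
    field_simp
    ring
  · rw [hK, AlgHom.toLinearMap_apply, map_pow, hσz, smul_pow, pow_mul]
  · rw [hF, skewF_apply, map_pow, hτz, smul_pow, smul_mul_assoc]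
    rcases m with _ | m
    · simp [qint]
    · rw [mul_pow_of_weyl (Da_mul_Za p q), add_sub_cancel_right, smul_smul,
        inv_mul_cancel_left₀ hb, gaussNum_inv_sq hq0 hb, Nat.add_sub_cancel]
  · rw [hE, skewE_apply, map_pow, hσd, smul_pow, mul_smul_comm]
    rcases n with _ | n
    · simp [qint]
    · rw [pow_mul_of_weyl (Da_mul_Za p q), add_sub_cancel_right, smul_smul,
        inv_mul_cancel_left₀ hb, gaussNum_inv_sq hq0 hb, Nat.add_sub_cancel, mul_comm]
  · rw [hK, AlgHom.toLinearMap_apply, map_pow, hσd, smul_pow, inv_pow, ← pow_mul, neg_mul,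
      zpow_neg]
    norm_cast
  · rw [hF, skewF_apply, map_pow, hτd, smul_pow, smul_mul_assoc, ← pow_succ, ← pow_succ']
    rw [show Da p q ^ (n + 1) - (q ^ 2) ^ n • Da p q ^ (n + 1)
      = (1 - (q ^ 2) ^ n) • Da p q ^ (n + 1) by module, smul_smul, qint]
    congr 1
    have := pow_ne_zero n hq0
    rw [← pow_mul, mul_comm 2 n, pow_mul, inv_pow]
    generalize q ^ n = x at *
    field_simp
    ring
  · rw [hE, skewE_apply, map_pow, hσl, smul_pow, mul_smul_comm, hlz]
    rw [show La p q ^ n * Za p q - q⁻¹ ^ n • (La p q ^ n * Za p q)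
      = (1 - q⁻¹ ^ n) • (La p q ^ n * Za p q) by module, smul_smul, qhint]
    congr 1
    have := pow_ne_zero n hq20
    rw [zpow_neg, zpow_natCast, inv_pow, show q ^ n = (q2 ^ n) ^ 2 by rw [hqq]; ring]
    generalize q2 ^ n = x at *
    field_simp
  · rw [hK, AlgHom.toLinearMap_apply, map_pow, hσl, smul_pow, inv_pow, zpow_neg, zpow_natCast]
  · rw [hF, skewF_apply, map_pow, hτl, smul_pow, smul_mul_assoc, hld]
    rw [show La p q ^ n * Da p q - q ^ n • (La p q ^ n * Da p q)
      = (1 - q ^ n) • (La p q ^ n * Da p q) by module, smul_smul, qhint]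
    congr 1
    have := pow_ne_zero n hq20
    rw [show q ^ n = (q2 ^ n) ^ 2 by rw [hqq]; ring]
    generalize q2 ^ n = x at *
    field_simp
    ring
  · rw [hE, hK, skewE_mul]; rfl
  · rw [map_pow, hF, hK, hlin, ← hτ, skewF_mul]; rfl
  · rw [hK]; exact map_mul σ a b
  · rw [hE, skewE_apply]; simp
  · rw [hF, skewF_apply]; simp
  · rw [hK]; exact map_one σ
end
end

section
/- Let A = ℂ_q[z,∂] ⊗ ℂ[λ]/(λ^{2p}−1) with q = exp(iπ/p). Then A is isomorphic as a ℂ-algebra to Mat_p(ℂ[λ]/(λ^{2p}−1)), the p×p matrix algebra over the group algebra of ℤ/2pℤ; in particular A is a semisimple 2p³-dimensional algebra. -/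
/-!
STATEMENT 17: For `q = exp(iπ/p)`, the algebra `A = ℂ_q[z,∂] ⊗ ℂ[λ]/(λ^{2p}−1)`
(relations `z^p = ∂^p = 0`, `∂z = (q−q⁻¹) + q⁻² z∂`, `λ` central, `λ^{2p} = 1`) is
isomorphic to `Mat_p(ℂ[λ]/(λ^{2p}−1))`, the `p×p` matrix algebra over the group algebra
of `ℤ/2pℤ`; in particular `A` is a semisimple algebra of dimension `2p³`.
-/

noncomputable section

namespace Aq

section ShiftMatrices

variable {R : Type*} [CommRing R]

/-- The matrix of the raising operator `e_j ↦ e_{j+1}`. -/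
def raising (p : ℕ) (R : Type*) [CommRing R] : Matrix (Fin p) (Fin p) R :=
  .of fun i j => if i.val = j.val + 1 then 1 else 0

/-- The matrix of the lowering operator `e_j ↦ a_j e_{j-1}`. -/
def lowering (p : ℕ) (a : ℕ → R) : Matrix (Fin p) (Fin p) R :=
  .of fun i j => if j.val = i.val + 1 then a j else 0

theorem raising_pow_apply (p n : ℕ) (i j : Fin p) :
    (raising p R ^ n) i j = if i.val = j.val + n then 1 else 0 := by
  induction n generalizing i j with
  | zero => simp [Matrix.one_apply, Fin.ext_iff]
  | succ n ih =>
    rw [pow_succ', Matrix.mul_apply]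
    simp only [ih]
    simp only [raising, Matrix.of_apply]
    by_cases h : i.val = j.val + (n + 1)
    · rw [Finset.sum_eq_single (⟨j.val + n, by omega⟩ : Fin p)]
      · rw [if_pos (by simp; omega), if_pos rfl, if_pos h, one_mul]
      · intro k _ hk
        rw [if_neg (fun h' => hk (Fin.ext (by simp; omega))), zero_mul]
      · simp
    · rw [if_neg h]
      refine Finset.sum_eq_zero fun k _ => ?_
      split_ifs <;> first | omega | simp

theorem lowering_pow_apply_eq_zero {p : ℕ} (a : ℕ → R) (n : ℕ) (i j : Fin p)
    (h : j.val ≠ i.val + n) : (lowering p a ^ n) i j = 0 := by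
  induction n generalizing i j with
  | zero => exact Matrix.one_apply_ne fun hij => h (by rw [hij, add_zero])
  | succ n ih =>
    rw [pow_succ', Matrix.mul_apply]
    refine Finset.sum_eq_zero fun k _ => ?_
    by_cases hk : j.val = k.val + n
    · rw [lowering, Matrix.of_apply, if_neg (by omega), zero_mul]
    · rw [ih k j hk, mul_zero]

theorem raising_pow_self (p : ℕ) : raising p R ^ p = 0 := by
  ext i j
  rw [raising_pow_apply, if_neg (by omega), Matrix.zero_apply]

theorem lowering_pow_self (p : ℕ) (a : ℕ → R) : lowering p a ^ p = 0 := by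
  ext i j
  exact lowering_pow_apply_eq_zero a p i j (by omega)

theorem raising_mul_lowering (p : ℕ) (a : ℕ → R) (h0 : a 0 = 0) :
    raising p R * lowering p a = Matrix.diagonal fun i : Fin p => a i := by
  ext i j
  rw [Matrix.mul_apply, Matrix.diagonal_apply]
  simp only [raising, lowering, Matrix.of_apply]
  by_cases h : i = j
  · subst h
    rw [if_pos rfl]
    by_cases hi : i.val = 0
    · rw [hi, h0]
      refine Finset.sum_eq_zero fun k _ => ?_
      rw [if_neg (by omega), zero_mul]
    · rw [Finset.sum_eq_single (⟨i.val - 1, by omega⟩ : Fin p)]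
      · rw [if_pos (by simp; omega), if_pos (by simp; omega), one_mul]
      · intro k _ hk
        rw [if_neg (fun h' => hk (Fin.ext (by simp; omega))), zero_mul]
      · simp
  · rw [if_neg h]
    have := fun h' => h (Fin.ext h')
    refine Finset.sum_eq_zero fun k _ => ?_
    split_ifs <;> first | omega | simp

theorem lowering_mul_raising (p : ℕ) (a : ℕ → R) (hp : a p = 0) :
    lowering p a * raising p R = Matrix.diagonal fun i : Fin p => a (i + 1) := by
  ext i j
  rw [Matrix.mul_apply, Matrix.diagonal_apply]
  simp only [raising, lowering, Matrix.of_apply]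
  by_cases h : i = j
  · subst h
    rw [if_pos rfl]
    by_cases hi : i.val + 1 = p
    · rw [hi, hp]
      refine Finset.sum_eq_zero fun k _ => ?_
      rw [if_neg (by omega), zero_mul]
    · rw [Finset.sum_eq_single (⟨i.val + 1, by omega⟩ : Fin p)]
      · simp
      · intro k _ hk
        rw [if_neg (fun h' => hk (Fin.ext (by simp; omega))), zero_mul]
      · simp
  · rw [if_neg h]
    have := fun h' => h (Fin.ext h')
    refine Finset.sum_eq_zero fun k _ => ?_
    split_ifs <;> first | omega | simp

theorem lowering_mul_single {p : ℕ} (a : ℕ → R) (i i' j : Fin p) (h : i'.val = i.val + 1) (r : R) :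
    lowering p a * Matrix.single i' j r = Matrix.single i j (a i' * r) := by
  ext k l
  by_cases hl : j = l
  · subst hl
    rw [Matrix.mul_single_apply_same, lowering, Matrix.of_apply]
    by_cases hk : i = k
    · subst hk; simp [h]
    · rw [Matrix.single_apply_of_row_ne hk, if_neg, zero_mul]
      exact fun h' => hk (Fin.ext (by omega))
  · rw [Matrix.mul_single_apply_of_ne _ _ _ _ _ (Ne.symm hl), Matrix.single_apply_of_col_ne _ _ hl]

theorem single_mul_lowering {p : ℕ} (a : ℕ → R) (i j j' : Fin p) (h : j'.val = j.val + 1) (r : R) :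
    Matrix.single i j r * lowering p a = Matrix.single i j' (r * a j') := by
  ext k l
  by_cases hk : i = k
  · subst hk
    rw [Matrix.single_mul_apply_same, lowering, Matrix.of_apply]
    by_cases hl : j' = l
    · subst hl; simp [h]
    · rw [Matrix.single_apply_of_col_ne _ _ hl, if_neg, mul_zero]
      exact fun h' => hl (Fin.ext (by omega))
  · rw [Matrix.single_mul_apply_of_ne _ _ _ _ _ (Ne.symm hk), Matrix.single_apply_of_row_ne hk]

/-- A subalgebra containing the shift operators (with invertible weights) contains all the
matrix units. -/
theorem single_mem_of_shifts_mem {K : Type*} [Field K] [Algebra K R] {p : ℕ} (a : ℕ → K)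
    (ha : ∀ n, 0 < n → n < p → a n ≠ 0) (S : Subalgebra K (Matrix (Fin p) (Fin p) R))
    (hz : raising p R ∈ S) (hd : lowering p (fun n => algebraMap K R (a n)) ∈ S) (i j : Fin p) :
    Matrix.single i j 1 ∈ S := by
  have cancel : ∀ (c : K) (i j : Fin p), c ≠ 0 →
      Matrix.single i j (algebraMap K R c) ∈ S → Matrix.single i j 1 ∈ S := by
    intro c i j hc h
    have := S.smul_mem h c⁻¹
    rwa [Matrix.smul_single, Algebra.smul_def, ← map_mul, inv_mul_cancel₀ hc, map_one] at this
  have col : ∀ n (i j : Fin p), i.val + n + 1 = p → j.val = 0 → Matrix.single i j 1 ∈ S := by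
    intro n
    induction n with
    | zero =>
      intro i j hi hj
      convert S.pow_mem hz (p - 1) using 1
      ext k l
      rw [raising_pow_apply, Matrix.single_apply]
      congr 1
      simp only [Fin.ext_iff, eq_iff_iff]
      omega
    | succ n ih =>
      intro i j hi hj
      have h := S.mul_mem hd (ih ⟨i.val + 1, by omega⟩ j (by simp; omega) hj)
      rw [lowering_mul_single _ i _ j rfl, mul_one] at h
      exact cancel _ _ _ (ha _ (by simp) (by simp; omega)) h
  have all : ∀ n (i j : Fin p), j.val = n → Matrix.single i j 1 ∈ S := by
    intro n
    induction n with
    | zero => exact fun i j hj => col (p - 1 - i.val) i j (by omega) hj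
    | succ n ih =>
      intro i j hj
      have h := S.mul_mem (ih i ⟨n, by omega⟩ rfl) hd
      rw [single_mul_lowering _ i _ j hj, one_mul] at h
      exact cancel _ _ _ (ha _ (by omega) j.isLt) h
  exact all _ i j rfl

end ShiftMatrices

/-- The weights `a_n = (q - q⁻¹) (1 + q⁻² + ⋯ + q^{-2(n-1)})` of the action of `∂`. -/
def weight (q : ℂ) (n : ℕ) : ℂ := (q - q⁻¹) * ∑ k ∈ Finset.range n, (q ^ 2)⁻¹ ^ k

theorem weight_zero (q : ℂ) : weight q 0 = 0 := by simp [weight]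

theorem weight_succ (q : ℂ) (n : ℕ) : weight q (n + 1) = (q - q⁻¹) + (q ^ 2)⁻¹ * weight q n := by
  rw [weight, weight, geom_sum_succ]
  ring

theorem weight_self {p : ℕ} (hp : 2 ≤ p) {q : ℂ} (hq : IsPrimitiveRoot (q ^ 2) p) :
    weight q p = 0 := by
  rw [weight, hq.inv.geom_sum_eq_zero hp, mul_zero]

theorem weight_ne_zero {p : ℕ} (hp : 2 ≤ p) {q : ℂ} (hq : IsPrimitiveRoot (q ^ 2) p) {n : ℕ}
    (h0 : 0 < n) (hn : n < p) : weight q n ≠ 0 := by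
  refine mul_ne_zero (fun h => ?_) (fun h => ?_)
  · have hq0 : q ≠ 0 := by
      rintro rfl
      exact hq.ne_zero (by omega) (by simp)
    refine hq.ne_one hp ?_
    rw [sq]
    nth_rewrite 2 [sub_eq_zero.mp h]
    exact mul_inv_cancel₀ hq0
  · have := mul_neg_geom_sum (q ^ 2)⁻¹ n
    rw [h, mul_zero, eq_comm, sub_eq_zero, eq_comm] at this
    exact hq.inv.pow_ne_one_of_pos_of_lt h0.ne' hn this

section Generators

variable (p : ℕ) (q : ℂ)

/-- The quotient map from the free algebra. -/
def mk : FreeAlgebra ℂ (Fin 3) →ₐ[ℂ] Aq p q := RingQuot.mkAlgHom ℂ (aRel p q)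

/-- The images in `A` of the generators `z`, `∂`, `λ`. -/
def gen (i : Fin 3) : Aq p q := mk p q (FreeAlgebra.ι ℂ i)

theorem mk_surjective : Function.Surjective (mk p q) := RingQuot.mkAlgHom_surjective ℂ (aRel p q)

variable {p q} in
theorem mk_eq {x y : FreeAlgebra ℂ (Fin 3)} (h : aRel p q x y) : mk p q x = mk p q y :=
  RingQuot.mkAlgHom_rel ℂ h

theorem gen_zero_pow : gen p q 0 ^ p = 0 := by
  simpa [gen] using mk_eq (aRel.znil (p := p) (q := q))

theorem gen_one_pow : gen p q 1 ^ p = 0 := by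
  simpa [gen] using mk_eq (aRel.dnil (p := p) (q := q))

theorem gen_two_pow : gen p q 2 ^ (2 * p) = 1 := by
  simpa [gen] using mk_eq (aRel.lord (p := p) (q := q))

theorem gen_one_mul_gen_zero :
    gen p q 1 * gen p q 0 =
      algebraMap ℂ _ (q - q⁻¹) + (q ^ 2)⁻¹ • (gen p q 0 * gen p q 1) := by
  rw [Algebra.algebraMap_eq_smul_one]
  have := mk_eq (aRel.dz (p := p) (q := q))
  rwa [map_mul, map_add, map_smul, map_smul, map_one, map_mul] at this

theorem commute_gen_two_zero : Commute (gen p q 2) (gen p q 0) := by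
  have := mk_eq (aRel.lz (p := p) (q := q))
  rwa [map_mul, map_mul] at this

theorem commute_gen_two_one : Commute (gen p q 2) (gen p q 1) := by
  have := mk_eq (aRel.ld (p := p) (q := q))
  rwa [map_mul, map_mul] at this

theorem gen_one_mul_gen_zero_pow (n : ℕ) :
    gen p q 1 * gen p q 0 ^ n =
      weight q n • gen p q 0 ^ (n - 1) + ((q ^ 2)⁻¹ ^ n) • (gen p q 0 ^ n * gen p q 1) := by
  induction n with
  | zero => simp [weight_zero]
  | succ n ih =>
    have key : gen p q 0 * (weight q n • gen p q 0 ^ (n - 1)) = weight q n • gen p q 0 ^ n := by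
      cases n with
      | zero => simp [weight_zero]
      | succ n => rw [mul_smul_comm, ← pow_succ', Nat.add_sub_cancel]
    rw [pow_succ', ← mul_assoc, gen_one_mul_gen_zero, add_mul, smul_mul_assoc, mul_assoc, ih,
      mul_add, key, mul_smul_comm, ← mul_assoc, smul_add, smul_smul, smul_smul, ← add_assoc,
      ← Algebra.smul_def, ← add_smul, weight_succ, ← pow_succ', ← pow_succ', Nat.add_sub_cancel]

/-- The span of the PBW monomials `z^i ∂^j λ^k` with `i, j < p` and `k < 2p`. -/
def monomialSpan : Submodule ℂ (Aq p q) :=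
  Submodule.span ℂ (Set.range fun x : Fin p × Fin p × Fin (2 * p) =>
    gen p q 0 ^ x.1.val * gen p q 1 ^ x.2.1.val * gen p q 2 ^ x.2.2.val)

variable {p}

theorem monomial_mem (hp : 0 < p) (i j k : ℕ) :
    gen p q 0 ^ i * gen p q 1 ^ j * gen p q 2 ^ k ∈ monomialSpan p q := by
  by_cases hi : i < p
  · by_cases hj : j < p
    · refine Submodule.subset_span ⟨(⟨i, hi⟩, ⟨j, hj⟩, ⟨k % (2 * p), Nat.mod_lt _ (by omega)⟩), ?_⟩
      simp only
      rw [← pow_eq_pow_mod k (gen_two_pow p q)]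
    · rw [pow_eq_zero_of_le (not_lt.mp hj) (gen_one_pow p q), mul_zero, zero_mul]
      exact zero_mem _
  · rw [pow_eq_zero_of_le (not_lt.mp hi) (gen_zero_pow p q), zero_mul, zero_mul]
    exact zero_mem _

theorem gen_mul_monomial_mem (hp : 0 < p) (t : Fin 3) (i j k : ℕ) :
    gen p q t * (gen p q 0 ^ i * gen p q 1 ^ j * gen p q 2 ^ k) ∈ monomialSpan p q := by
  fin_cases t
  · convert monomial_mem q hp (i + 1) j k using 1
    simp only [pow_succ', mul_assoc, Fin.zero_eta]
  · simp only [Fin.mk_one]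
    rw [← mul_assoc, ← mul_assoc, gen_one_mul_gen_zero_pow, add_mul, add_mul]
    simp only [smul_mul_assoc]
    refine add_mem (Submodule.smul_mem _ _ (monomial_mem q hp _ _ _)) (Submodule.smul_mem _ _ ?_)
    convert monomial_mem q hp i (j + 1) k using 1
    simp only [pow_succ', mul_assoc]
  · convert monomial_mem q hp i j (k + 1) using 1
    change gen p q 2 * _ = _
    rw [pow_succ', ← mul_assoc, ← mul_assoc (gen p q 0 ^ i * gen p q 1 ^ j) (gen p q 2)]
    exact congr_arg (· * gen p q 2 ^ k) (((commute_gen_two_zero p q).pow_right i).mul_right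
      ((commute_gen_two_one p q).pow_right j)).eq

theorem monomialSpan_eq_top (hp : 0 < p) : monomialSpan p q = ⊤ := by
  have hgen : ∀ t, ∀ s ∈ monomialSpan p q, gen p q t * s ∈ monomialSpan p q := by
    intro t s hs
    refine Submodule.span_induction ?_ ?_ ?_ ?_ hs
    · rintro _ ⟨x, rfl⟩
      exact gen_mul_monomial_mem q hp t _ _ _
    · rw [mul_zero]; exact zero_mem _
    · intro x y _ _ hx hy
      rw [mul_add]; exact add_mem hx hy
    · intro c x _ hx
      rw [mul_smul_comm]; exact Submodule.smul_mem _ _ hx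
  have hmk : ∀ x, ∀ s ∈ monomialSpan p q, mk p q x * s ∈ monomialSpan p q := by
    intro x
    induction x with
    | grade0 r =>
      intro s hs
      rw [AlgHom.commutes, ← Algebra.smul_def]
      exact Submodule.smul_mem _ _ hs
    | grade1 t => exact hgen t
    | mul a b ha hb =>
      intro s hs
      rw [map_mul, mul_assoc]
      exact ha _ (hb _ hs)
    | add a b ha hb =>
      intro s hs
      rw [map_add, add_mul]
      exact add_mem (ha _ hs) (hb _ hs)
  refine eq_top_iff.mpr fun x _ => ?_
  obtain ⟨y, rfl⟩ := mk_surjective p q x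
  have h1 : (1 : Aq p q) ∈ monomialSpan p q := by simpa using monomial_mem q hp 0 0 0
  simpa using hmk y 1 h1

theorem finite (hp : 0 < p) : Module.Finite ℂ (Aq p q) :=
  ⟨monomialSpan_eq_top q hp ▸ Submodule.fg_span (Set.finite_range _)⟩

theorem finrank_le (hp : 0 < p) : Module.finrank ℂ (Aq p q) ≤ 2 * p ^ 3 := by
  rw [← finrank_top ℂ (Aq p q), ← monomialSpan_eq_top q hp]
  refine (finrank_range_le_card _).trans_eq ?_
  simp only [Fintype.card_prod, Fintype.card_fin]
  ring

end Generators

section Representation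

variable (p : ℕ)

/-- The group algebra of `ℤ/2pℤ`. -/
abbrev GroupAlg : Type := MonoidAlgebra ℂ (Multiplicative (ZMod (2 * p)))

/-- The generator `λ` of the group algebra. -/
def groupGen : GroupAlg p := MonoidAlgebra.of ℂ _ (Multiplicative.ofAdd 1)

theorem groupGen_pow (k : ℕ) :
    groupGen p ^ k = MonoidAlgebra.of ℂ _ (Multiplicative.ofAdd (k : ZMod (2 * p))) := by
  rw [groupGen, ← map_pow, ← ofAdd_nsmul, nsmul_one]

/-- The matrices by which `z`, `∂`, `λ` act. -/
def genMatrix (q : ℂ) : Fin 3 → Matrix (Fin p) (Fin p) (GroupAlg p) :=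
  ![raising p _, lowering p fun n => algebraMap ℂ _ (weight q n), algebraMap _ _ (groupGen p)]

theorem lift_genMatrix_rel {p : ℕ} (hp : 2 ≤ p) {q : ℂ} (hq : IsPrimitiveRoot (q ^ 2) p)
    ⦃x y : FreeAlgebra ℂ (Fin 3)⦄ (h : aRel p q x y) :
    FreeAlgebra.lift ℂ (genMatrix p q) x = FreeAlgebra.lift ℂ (genMatrix p q) y := by
  cases h with
  | znil => simp [genMatrix, raising_pow_self]
  | dnil => simp [genMatrix, lowering_pow_self]
  | dz =>
    simp only [map_mul, map_add, map_smul, map_one, FreeAlgebra.lift_ι_apply, genMatrix,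
      Matrix.cons_val_zero, Matrix.cons_val_one]
    rw [lowering_mul_raising p (fun n => algebraMap ℂ _ (weight q n)) (by simp [weight_self hp hq]),
      raising_mul_lowering p (fun n => algebraMap ℂ _ (weight q n)) (by simp [weight_zero])]
    refine Matrix.ext fun i j => ?_
    rw [Matrix.add_apply, Matrix.smul_apply, Matrix.smul_apply]
    by_cases hij : i = j
    · subst hij
      rw [Matrix.diagonal_apply_eq, Matrix.diagonal_apply_eq, Matrix.one_apply_eq, weight_succ,
        Algebra.smul_def, Algebra.smul_def, map_add, map_mul, mul_one]
    · simp [hij]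
  | lz => simpa [genMatrix] using Algebra.commutes _ _
  | ld => simpa [genMatrix] using Algebra.commutes _ _
  | lord =>
    simp only [map_pow, map_one, FreeAlgebra.lift_ι_apply, genMatrix, Matrix.cons_val]
    rw [← map_pow, groupGen_pow, ZMod.natCast_self, ofAdd_zero, map_one, map_one]

/-- The representation of `A` by matrices over the group algebra. -/
def toMatrix {p : ℕ} (hp : 2 ≤ p) {q : ℂ} (hq : IsPrimitiveRoot (q ^ 2) p) :
    Aq p q →ₐ[ℂ] Matrix (Fin p) (Fin p) (GroupAlg p) :=
  RingQuot.liftAlgHom ℂ ⟨FreeAlgebra.lift ℂ (genMatrix p q), lift_genMatrix_rel hp hq⟩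

theorem toMatrix_gen {p : ℕ} (hp : 2 ≤ p) {q : ℂ} (hq : IsPrimitiveRoot (q ^ 2) p) (t : Fin 3) :
    toMatrix hp hq (gen p q t) = genMatrix p q t :=
  (RingQuot.liftAlgHom_mkAlgHom_apply ℂ _ _ _).trans (FreeAlgebra.lift_ι_apply _ _)

theorem toMatrix_surjective {p : ℕ} (hp : 2 ≤ p) {q : ℂ} (hq : IsPrimitiveRoot (q ^ 2) p) :
    Function.Surjective (toMatrix hp hq) := by
  have : NeZero (2 * p) := ⟨by omega⟩
  have mem (t : Fin 3) : genMatrix p q t ∈ (toMatrix hp hq).range := ⟨_, toMatrix_gen hp hq t⟩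
  have unit := single_mem_of_shifts_mem (R := GroupAlg p) (weight q)
    (fun n => weight_ne_zero hp hq) (toMatrix hp hq).range (mem 0) (mem 1)
  have all (i j : Fin p) (r : GroupAlg p) : Matrix.single i j r ∈ (toMatrix hp hq).range := by
    induction r using MonoidAlgebra.induction_linear with
    | zero => rw [Matrix.single_zero]; exact zero_mem _
    | add x y hx hy => rw [Matrix.single_add]; exact add_mem hx hy
    | single g c =>
      have h := (toMatrix hp hq).range.smul_mem
        (mul_mem (pow_mem (mem 2) g.toAdd.val) (unit i j)) c
      convert h using 1
      simp only [genMatrix, Matrix.cons_val]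
      rw [← map_pow, groupGen_pow, ← Algebra.smul_def, Matrix.smul_single, Matrix.smul_single,
        ZMod.natCast_zmod_val, ofAdd_toAdd]
      simp
  intro M
  change M ∈ (toMatrix hp hq).range
  rw [Matrix.matrix_eq_sum_single M]
  exact sum_mem fun i _ => sum_mem fun j _ => all i j _

theorem finrank_matrix_groupAlg {p : ℕ} (hp : 0 < p) :
    Module.finrank ℂ (Matrix (Fin p) (Fin p) (GroupAlg p)) = 2 * p ^ 3 := by
  have : NeZero (2 * p) := ⟨by omega⟩
  rw [Module.finrank_matrix, (MonoidAlgebra.coeffLinearEquiv ℂ).finrank_eq,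
    Module.finrank_finsupp_self]
  simp only [Fintype.card_fin, Fintype.card_multiplicative, ZMod.card]
  ring

end Representation

end Aq

theorem Aq_matrix_algebra_over_group_algebra
    (p : ℕ) (hp : 2 ≤ p)
    (q : ℂ) (hq : q = Complex.exp (Real.pi * Complex.I / p)) :
    Nonempty (Aq p q ≃ₐ[ℂ]
        Matrix (Fin p) (Fin p) (MonoidAlgebra ℂ (Multiplicative (ZMod (2 * p))))) ∧
      Module.finrank ℂ (Aq p q) = 2 * p ^ 3 ∧
      IsSemisimpleRing (Aq p q) := by
  have hroot : IsPrimitiveRoot (q ^ 2) p := by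
    convert Complex.isPrimitiveRoot_exp p (by omega) using 1
    rw [hq, ← Complex.exp_nat_mul]
    congr 1
    push_cast
    ring
  have : NeZero (2 * p) := ⟨by omega⟩
  have := Aq.finite q (p := p) (by omega)
  have hsurj := Aq.toMatrix_surjective hp hroot
  have hdim := Aq.finrank_matrix_groupAlg (p := p) (by omega)
  have : Module.Finite ℂ (Matrix (Fin p) (Fin p) (Aq.GroupAlg p)) :=
    .of_surjective (Aq.toMatrix hp hroot).toLinearMap hsurj
  have hrank : Module.finrank ℂ (Aq p q) = 2 * p ^ 3 :=
    (Aq.finrank_le q (by omega)).antisymm <|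
      hdim ▸ (Aq.toMatrix hp hroot).toLinearMap.finrank_le_finrank_of_surjective hsurj
  have hinj : Function.Injective (Aq.toMatrix hp hroot) :=
    (LinearMap.injective_iff_surjective_of_finrank_eq_finrank
      (f := (Aq.toMatrix hp hroot).toLinearMap) (hrank.trans hdim.symm)).mpr hsurj
  let e := AlgEquiv.ofBijective (Aq.toMatrix hp hroot) ⟨hinj, hsurj⟩
  exact ⟨⟨e⟩, hrank, e.symm.toRingEquiv.isSemisimpleRing⟩
end
end

section
/- For a finite-dimensional Hopf algebra B with bijective antipode, the map S_D(μ⊗m) = (S(m''') ⇀ (S*)⁻¹(μ) ↼ m') ⊗ S(m'') is an antipode for the Drinfeld double D(B): it satisfies S_D((μ⊗m)') (μ⊗m)'' = ε_D(μ⊗m) 1_D = (μ⊗m)' S_D((μ⊗m)'') for all μ⊗m ∈ D(B). -/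
/-!
STATEMENT 18: For a finite-dimensional Hopf algebra `B` with bijective antipode, the map
`S_D(μ⊗m) = (S(m''') ⇀ (S*)⁻¹(μ) ↼ m') ⊗ S(m'')` is an antipode for the Drinfeld double
`D(B)`: `S_D((μ⊗m)') (μ⊗m)'' = ε_D(μ⊗m) 1_D = (μ⊗m)' S_D((μ⊗m)'')`, where
`(μ⊗m)' ⊗ (μ⊗m)'' = (μ''⊗m') ⊗ (μ'⊗m'')` (coalgebra of `B*^cop ⊗ B`),
`ε_D(μ⊗m) = μ(1)ε(m)` and `1_D = ε ⊗ 1`.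
-/

open TensorProduct

noncomputable section

variable {k B : Type*} [Field k] [Ring B] [HopfAlgebra k B]

/-- Convolution product on the dual `B*`. -/
def dualMul (α β : Module.Dual k B) : Module.Dual k B :=
  (TensorProduct.lift ((LinearMap.mul k k).compl₁₂ α β)).comp Coalgebra.comul

open Coalgebra HopfAlgebra WithConv

section Convolution

variable {A A' : Type*} [Semiring A] [Algebra k A] [Semiring A'] [Algebra k A']

lemma conv_apply_of_comul_eq {ι : Type*} {s : Finset ι} {m : B} {m1 m2 : ι → B}
    (h : comul (R := k) m = ∑ j ∈ s, m1 j ⊗ₜ[k] m2 j) (f g : WithConv (B →ₗ[k] A)) :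
    (f * g) m = ∑ j ∈ s, f (m1 j) * g (m2 j) := by
  simp [h]

lemma conv_apply_of_comul_comul_eq {ι : Type*} {s : Finset ι} {m : B} {m1 m2 m3 : ι → B}
    (h : (TensorProduct.map (comul (R := k)) LinearMap.id) (comul (R := k) m)
      = ∑ j ∈ s, (m1 j ⊗ₜ[k] m2 j) ⊗ₜ[k] m3 j) (f g l : WithConv (B →ₗ[k] A)) :
    (f * g * l) m = ∑ j ∈ s, f (m1 j) * g (m2 j) * l (m3 j) := by
  have key : (f * g * l) m = LinearMap.mul' k A (TensorProduct.map
      (LinearMap.mul' k A ∘ₗ TensorProduct.map f.ofConv g.ofConv) l.ofConv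
      ((TensorProduct.map (comul (R := k)) LinearMap.id) (comul (R := k) m))) := by
    rw [← LinearMap.comp_apply (TensorProduct.map _ _) (TensorProduct.map _ _),
      ← TensorProduct.map_comp]
    rfl
  rw [key, h]
  simp

lemma algHom_conv_eq_one (φ : A →ₐ[k] A') {f g : B →ₗ[k] A}
    (h : toConv f * toConv g = 1) :
    toConv (φ.toLinearMap ∘ₗ f) * toConv (φ.toLinearMap ∘ₗ g) = 1 := by
  have := LinearMap.algHom_comp_convMul_distrib φ (toConv f) (toConv g)
  rw [h] at this
  apply WithConv.ofConv_injective
  rw [← this]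
  ext x
  simp

lemma conv_mul_antipode_cancel_left (f g : WithConv (B →ₗ[k] A)) (φ ψ : B →ₐ[k] A) :
    f * (g * toConv (ψ.toLinearMap ∘ₗ antipode k) * toConv (φ.toLinearMap ∘ₗ antipode k)) *
      toConv (φ.toLinearMap ∘ₗ LinearMap.id) * toConv (ψ.toLinearMap ∘ₗ LinearMap.id) = f * g := by
  have hS : toConv (antipode k (A := B)) * toConv LinearMap.id = 1 := LinearMap.antipode_mul_id
  simp only [mul_assoc]
  rw [← mul_assoc (toConv (φ.toLinearMap ∘ₗ antipode k)),
    algHom_conv_eq_one _ hS, one_mul, algHom_conv_eq_one _ hS, mul_one]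

lemma conv_nested_eq_one {a b c d e f : WithConv (B →ₗ[k] A)} (hcd : c * d = 1)
    (hbe : b * e = 1) (haf : a * f = 1) : a * b * c * (d * e * f) = 1 := by
  rw [show a * b * c * (d * e * f) = a * (b * (c * d) * e) * f by simp only [mul_assoc],
    hcd, mul_one, hbe, mul_one, haf]

end Convolution

lemma comul_antipode_eq (m : B) :
    comul (R := k) (antipode k m) = TensorProduct.map (antipode k) (antipode k)
      (TensorProduct.comm k B B (comul (R := k) m)) := by
  let i₁ : B →ₐ[k] B ⊗[k] B := Algebra.TensorProduct.includeLeft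
  let i₂ : B →ₐ[k] B ⊗[k] B := Algebra.TensorProduct.includeRight
  let S : B →ₗ[k] B := antipode k
  have hδ : toConv (comul (R := k) (A := B)) =
      toConv (i₁.toLinearMap ∘ₗ LinearMap.id) * toConv (i₂.toLinearMap ∘ₗ LinearMap.id) := by
    ext x
    rw [conv_apply_of_comul_eq (ℛ k x).eq.symm]
    simp [i₁, i₂, (ℛ k x).eq]
  have hG : toConv (TensorProduct.map S S ∘ₗ (TensorProduct.comm k B B).toLinearMap ∘ₗ comul) =
      toConv (i₂.toLinearMap ∘ₗ S) * toConv (i₁.toLinearMap ∘ₗ S) := by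
    ext x
    rw [conv_apply_of_comul_eq (ℛ k x).eq.symm]
    simp only [LinearMap.comp_apply, ← (ℛ k x).eq]
    simp [i₁, i₂]
  have hS : toConv S * toConv LinearMap.id = 1 := LinearMap.antipode_mul_id
  have hl : toConv (TensorProduct.map S S ∘ₗ (TensorProduct.comm k B B).toLinearMap ∘ₗ comul) *
      toConv (comul (R := k) (A := B)) = 1 := by
    rw [hδ, hG, mul_assoc, ← mul_assoc (toConv (i₁.toLinearMap ∘ₗ S)),
      algHom_conv_eq_one i₁ hS, one_mul, algHom_conv_eq_one i₂ hS]
  have := left_inv_eq_right_inv hl LinearMap.comul_right_inv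
  exact (LinearMap.congr_fun (congrArg WithConv.ofConv this) m).symm

lemma comul_comul_antipode_eq_sum {ι : Type*} {s : Finset ι} {m : B} {m1 m2 m3 : ι → B}
    (h : (TensorProduct.map (comul (R := k)) LinearMap.id) (comul (R := k) m)
      = ∑ j ∈ s, (m1 j ⊗ₜ[k] m2 j) ⊗ₜ[k] m3 j) :
    (TensorProduct.map (comul (R := k)) LinearMap.id) (comul (R := k) (antipode k m))
      = ∑ j ∈ s, (antipode k (m3 j) ⊗ₜ[k] antipode k (m2 j)) ⊗ₜ[k] antipode k (m1 j) := by
  let S : B →ₗ[k] B := antipode k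
  have key : ∀ t : B ⊗[k] B, (TensorProduct.map (comul (R := k)) LinearMap.id)
      (TensorProduct.map S S (TensorProduct.comm k B B t)) =
      TensorProduct.map (TensorProduct.map S S ∘ₗ (TensorProduct.comm k B B).toLinearMap) S
        (TensorProduct.comm k _ _ (LinearMap.lTensor B (comul (R := k)) t)) := by
    intro t
    induction t with
    | zero => simp
    | add x y hx hy => simp only [map_add, hx, hy]
    | tmul x y => simp [S, comul_antipode_eq]
  rw [comul_antipode_eq, key, ← Coalgebra.coassoc_apply]
  change TensorProduct.map _ _ (TensorProduct.comm k _ _ (TensorProduct.assoc k B B B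
    ((TensorProduct.map (comul (R := k)) LinearMap.id) (comul (R := k) m)))) = _
  rw [h]
  simp [S]

lemma exists_eq_sum_tmul_tmul [FiniteDimensional k B] (t : (B ⊗[k] B) ⊗[k] B) :
    ∃ (M : ℕ) (m1 m2 m3 : Fin M → B), t = ∑ j, (m1 j ⊗ₜ[k] m2 j) ⊗ₜ[k] m3 j := by
  let b := Module.finBasis k B
  let c := (b.tensorProduct b).tensorProduct b
  let e := (Fintype.equivFin ((Fin (Module.finrank k B) × Fin (Module.finrank k B)) ×
    Fin (Module.finrank k B))).symm
  refine ⟨_, fun j => c.repr t (e j) • b (e j).1.1, fun j => b (e j).1.2, fun j => b (e j).2, ?_⟩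
  rw [e.sum_comp (fun p => ((c.repr t p • b p.1.1) ⊗ₜ[k] b p.1.2) ⊗ₜ[k] b p.2)]
  refine (c.sum_repr t).symm.trans (Finset.sum_congr rfl ?_)
  rintro ⟨⟨i, j⟩, l⟩ -
  simp only [c, Module.Basis.tensorProduct_apply, TensorProduct.smul_tmul']

lemma dual_tmul_ext [FiniteDimensional k B] {s t : Module.Dual k B ⊗[k] B}
    (h : ∀ x, dualTensorHom k B B s x = dualTensorHom k B B t x) : s = t :=
  (dualTensorHomEquiv (R := k) (M := B) (N := B)).injective (LinearMap.ext h)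

lemma dualMul_apply_eq_sum (α β : Module.Dual k B) (x : B) {ι : Type*} (r : Coalgebra.Repr k x ι) :
    dualMul α β x = ∑ i ∈ r.index, α (r.left i) * β (r.right i) := by
  simp [dualMul, ← r.eq]

lemma sum_comm_dependent {V ι κ ρ : Type*} [AddCommMonoid V] [Fintype ι] [Fintype κ]
    (s : Finset ρ) {L : κ → ℕ} {K : ∀ j, Fin (L j) → ℕ}
    (F : ι → ∀ j, ρ → ∀ l : Fin (L j), Fin (K j l) → V) :
    ∑ i, ∑ j, ∑ l, ∑ n, ∑ r ∈ s, F i j r l n = ∑ r ∈ s, ∑ j, ∑ l, ∑ n, ∑ i, F i j r l n := by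
  rw [Finset.sum_comm, Finset.sum_comm (s := s)]
  refine Finset.sum_congr rfl fun j _ => ?_
  rw [Finset.sum_comm, Finset.sum_comm (s := s)]
  refine Finset.sum_congr rfl fun l _ => ?_
  rw [Finset.sum_comm, Finset.sum_comm (s := s)]
  refine Finset.sum_congr rfl fun n _ => ?_
  rw [Finset.sum_comm]

lemma inverse_antipode_mul {Sinv : B →ₗ[k] B} (hl : ∀ x, antipode k (Sinv x) = x)
    (hr : ∀ x, Sinv (antipode k x) = x) (x y : B) : Sinv (x * y) = Sinv y * Sinv x := by
  rw [← hr (Sinv y * Sinv x), antipode_mul_antidistrib, hl, hl]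

lemma sum_mul_inverse_antipode {Sinv : B →ₗ[k] B} (hl : ∀ x, antipode k (Sinv x) = x)
    (hr : ∀ x, Sinv (antipode k x) = x) {ι : Type*} {x : B} (r : Coalgebra.Repr k x ι) :
    ∑ i ∈ r.index, r.right i * Sinv (r.left i) = counit (R := k) x • 1 := by
  have h : antipode k (∑ i ∈ r.index, r.right i * Sinv (r.left i)) =
      counit (R := k) x • (1 : B) := by
    simp only [map_sum, antipode_mul_antidistrib, hl, sum_mul_antipode_eq_smul]
  rw [← hr (∑ i ∈ r.index, _), h, map_smul, show Sinv 1 = 1 by simpa using hr 1]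

lemma sum_inverse_antipode_mul {Sinv : B →ₗ[k] B} (hl : ∀ x, antipode k (Sinv x) = x)
    (hr : ∀ x, Sinv (antipode k x) = x) {ι : Type*} {x : B} (r : Coalgebra.Repr k x ι) :
    ∑ i ∈ r.index, Sinv (r.right i) * r.left i = counit (R := k) x • 1 := by
  have h : antipode k (∑ i ∈ r.index, Sinv (r.right i) * r.left i) =
      counit (R := k) x • (1 : B) := by
    simp only [map_sum, antipode_mul_antidistrib, hl, sum_antipode_mul_eq_smul]
  rw [← hr (∑ i ∈ r.index, _), h, map_smul, show Sinv 1 = 1 by simpa using hr 1]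

section DoubleConvolution

variable (k B) in
/-- Left multiplication, acting on the endomorphism factor. -/
def leftMulAlgHom : B →ₐ[k] Module.End k B ⊗[k] B :=
  Algebra.TensorProduct.includeLeft.comp (Algebra.lmul k B)

variable (k B) in
/-- Right multiplication, acting on the endomorphism factor. -/
def rightMulMap : B →ₗ[k] Module.End k B ⊗[k] B :=
  (TensorProduct.mk k _ _).flip 1 ∘ₗ (LinearMap.mul k B).flip

/-- The map `φ ⊗ b ↦ μ (φ z) • b`. -/
def endEval (μ : Module.Dual k B) (z : B) : Module.End k B ⊗[k] B →ₗ[k] B :=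
  (TensorProduct.lid k B).toLinearMap ∘ₗ
    TensorProduct.map (μ ∘ₗ LinearMap.applyₗ z) LinearMap.id

lemma endEval_tmul (μ : Module.Dual k B) (z : B) (φ : Module.End k B) (b : B) :
    endEval μ z (φ ⊗ₜ b) = μ (φ z) • b := by
  simp [endEval]

variable (k B) in
/-- Left multiplication, as a map into the opposite of the endomorphism factor. -/
def opLeftMap : B →ₗ[k] (Module.End k B)ᵐᵒᵖ ⊗[k] B :=
  (TensorProduct.mk k _ _).flip 1 ∘ₗ (MulOpposite.opLinearEquiv k).toLinearMap ∘ₗ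
    LinearMap.mul k B

variable (k B) in
/-- Right multiplication, as a map into the opposite of the endomorphism factor. -/
def opRightMap : B →ₗ[k] (Module.End k B)ᵐᵒᵖ ⊗[k] B :=
  (TensorProduct.mk k _ _).flip 1 ∘ₗ (MulOpposite.opLinearEquiv k).toLinearMap ∘ₗ
    (LinearMap.mul k B).flip

/-- The map `φ ⊗ b ↦ μ (S⁻¹ (φ z) y) • b`. -/
def opEval (Sinv : B →ₗ[k] B) (μ : Module.Dual k B) (y z : B) :
    (Module.End k B)ᵐᵒᵖ ⊗[k] B →ₗ[k] B :=
  (TensorProduct.lid k B).toLinearMap ∘ₗ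
    TensorProduct.map (μ ∘ₗ LinearMap.mulRight k y ∘ₗ Sinv ∘ₗ LinearMap.applyₗ z ∘ₗ
      (MulOpposite.opLinearEquiv k).symm.toLinearMap) LinearMap.id

lemma opEval_tmul (Sinv : B →ₗ[k] B) (μ : Module.Dual k B) (y z : B) (φ : (Module.End k B)ᵐᵒᵖ)
    (b : B) : opEval Sinv μ y z (φ ⊗ₜ b) = μ (Sinv (φ.unop z) * y) • b := by
  simp [opEval]

lemma op_conv_eq_one {Sinv : B →ₗ[k] B} (hl : ∀ x, antipode k (Sinv x) = x)
    (hr : ∀ x, Sinv (antipode k x) = x) :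
    (toConv (opRightMap k B) *
      toConv ((Algebra.TensorProduct.includeRight :
        B →ₐ[k] (Module.End k B)ᵐᵒᵖ ⊗[k] B).toLinearMap ∘ₗ LinearMap.id) *
      toConv (opLeftMap k B ∘ₗ Sinv)) *
    (toConv (opLeftMap k B) *
      toConv ((Algebra.TensorProduct.includeRight :
        B →ₐ[k] (Module.End k B)ᵐᵒᵖ ⊗[k] B).toLinearMap ∘ₗ antipode k) *
      toConv (opRightMap k B ∘ₗ antipode k)) = 1 := by
  have hS : toConv LinearMap.id * toConv (antipode k (A := B)) = 1 := LinearMap.id_mul_antipode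
  have hL : toConv (opLeftMap k B ∘ₗ Sinv) * toConv (opLeftMap k B) = 1 := by
    ext x
    have h : ∀ a b : B, opLeftMap k B a * opLeftMap k B b = opLeftMap k B (b * a) := by
      intro a b
      have h' : LinearMap.mul k B b * LinearMap.mul k B a = LinearMap.mul k B (b * a) := by
        ext z
        simp [mul_assoc]
      simp only [opLeftMap, LinearMap.comp_apply, LinearMap.flip_apply, TensorProduct.mk_apply,
        LinearEquiv.coe_coe, MulOpposite.coe_opLinearEquiv, Algebra.TensorProduct.tmul_mul_tmul,
        ← MulOpposite.op_mul, h', mul_one]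
    have h1 : opLeftMap k B 1 = 1 := by
      have h' : LinearMap.mul k B 1 = 1 := by
        ext z
        simp
      simp only [opLeftMap, LinearMap.comp_apply, LinearMap.flip_apply, TensorProduct.mk_apply,
        LinearEquiv.coe_coe, MulOpposite.coe_opLinearEquiv, h', MulOpposite.op_one,
        Algebra.TensorProduct.one_def]
    rw [conv_apply_of_comul_eq (ℛ k x).eq.symm]
    simp only [LinearMap.comp_apply, h, ← map_sum, sum_mul_inverse_antipode hl hr]
    simp [h1, Algebra.algebraMap_eq_smul_one]
  have hR : toConv (opRightMap k B) * toConv (opRightMap k B ∘ₗ antipode k) = 1 := by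
    ext x
    have h : ∀ a b : B, opRightMap k B a * opRightMap k B b = opRightMap k B (a * b) := by
      intro a b
      have h' : (LinearMap.mul k B).flip b * (LinearMap.mul k B).flip a =
          (LinearMap.mul k B).flip (a * b) := by
        ext z
        simp [mul_assoc]
      simp only [opRightMap, LinearMap.comp_apply, LinearMap.flip_apply (TensorProduct.mk k _ _),
        TensorProduct.mk_apply, LinearEquiv.coe_coe, MulOpposite.coe_opLinearEquiv,
        Algebra.TensorProduct.tmul_mul_tmul,
        ← MulOpposite.op_mul, h', mul_one]
    have h1 : opRightMap k B 1 = 1 := by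
      have h' : (LinearMap.mul k B).flip 1 = 1 := by
        ext z
        simp
      simp only [opRightMap, LinearMap.comp_apply, LinearMap.flip_apply (TensorProduct.mk k _ _),
        TensorProduct.mk_apply, LinearEquiv.coe_coe, MulOpposite.coe_opLinearEquiv,
        h', MulOpposite.op_one,
        Algebra.TensorProduct.one_def]
    rw [conv_apply_of_comul_eq (ℛ k x).eq.symm]
    simp only [LinearMap.comp_apply, h, ← map_sum, sum_mul_antipode_eq_smul]
    simp [h1, Algebra.algebraMap_eq_smul_one]
  exact conv_nested_eq_one hL (algHom_conv_eq_one _ hS) hR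

end DoubleConvolution

theorem drinfeld_double_antipode_axioms
    [FiniteDimensional k B]
    (S : B →ₗ[k] B) (hSdef : S = HopfAlgebra.antipode (R := k) (A := B))
    (Sinv : B →ₗ[k] B)
    (hSinv : ∀ x : B, S (Sinv x) = x ∧ Sinv (S x) = x)
    -- the Drinfeld double multiplication `(μ⊗m)(ν⊗n) = μ(m' ⇀ ν ↼ S⁻¹(m''')) ⊗ m''n`:
    (mulD : (Module.Dual k B ⊗[k] B) →ₗ[k] (Module.Dual k B ⊗[k] B) →ₗ[k]
        (Module.Dual k B ⊗[k] B))
    (mulD_def : ∀ (μ ν : Module.Dual k B) (m n : B)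
        (M : ℕ) (m1 m2 m3 : Fin M → B)
        (_ : (TensorProduct.map (Coalgebra.comul (R := k)) LinearMap.id)
              (Coalgebra.comul (R := k) m) = ∑ j, (m1 j ⊗ₜ[k] m2 j) ⊗ₜ[k] m3 j),
        mulD (μ ⊗ₜ[k] m) (ν ⊗ₜ[k] n)
          = ∑ j, (dualMul μ
              (ν ∘ₗ (LinearMap.mulLeft k (Sinv (m3 j))) ∘ₗ (LinearMap.mulRight k (m1 j))))
              ⊗ₜ[k] (m2 j * n))
    -- the candidate antipode `S_D(μ⊗m) = (S(m''') ⇀ (S*)⁻¹(μ) ↼ m') ⊗ S(m'')`: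
    (SD : (Module.Dual k B ⊗[k] B) →ₗ[k] (Module.Dual k B ⊗[k] B))
    (SD_def : ∀ (μ : Module.Dual k B) (m : B)
        (M : ℕ) (m1 m2 m3 : Fin M → B)
        (_ : (TensorProduct.map (Coalgebra.comul (R := k)) LinearMap.id)
              (Coalgebra.comul (R := k) m) = ∑ j, (m1 j ⊗ₜ[k] m2 j) ⊗ₜ[k] m3 j),
        SD (μ ⊗ₜ[k] m)
          = ∑ j, ((μ ∘ₗ Sinv) ∘ₗ (LinearMap.mulLeft k (m1 j)) ∘ₗ
                (LinearMap.mulRight k (S (m3 j)))) ⊗ₜ[k] S (m2 j)) :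
    -- antipode axioms
    ∀ (μ : Module.Dual k B) (m : B)
      (N : ℕ) (μ1 μ2 : Fin N → Module.Dual k B)
      (_ : ∀ x y : B, μ (x * y) = ∑ i, μ1 i x * μ2 i y)
      (M : ℕ) (m1 m2 : Fin M → B)
      (_ : Coalgebra.comul (R := k) m = ∑ j, m1 j ⊗ₜ[k] m2 j),
      (∑ i, ∑ j, mulD (SD (μ2 i ⊗ₜ[k] m1 j)) (μ1 i ⊗ₜ[k] m2 j)
          = (μ 1 * Coalgebra.counit (R := k) m) •
              ((Coalgebra.counit : Module.Dual k B) ⊗ₜ[k] (1 : B))) ∧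
      (∑ i, ∑ j, mulD (μ2 i ⊗ₜ[k] m1 j) (SD (μ1 i ⊗ₜ[k] m2 j))
          = (μ 1 * Coalgebra.counit (R := k) m) •
              ((Coalgebra.counit : Module.Dual k B) ⊗ₜ[k] (1 : B))) := by
  subst hSdef
  have hl : ∀ x, antipode k (Sinv x) = x := fun x => (hSinv x).1
  have hr : ∀ x, Sinv (antipode k x) = x := fun x => (hSinv x).2
  intro μ m N μ1 μ2 hμ M m1 m2 hm
  have hSm := inverse_antipode_mul hl hr
  constructor
  · choose L p1 p2 p3 hp using fun j => exists_eq_sum_tmul_tmul (k := k)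
      ((TensorProduct.map (comul (R := k)) LinearMap.id) (comul (R := k) (m1 j)))
    choose K u v w hq using fun j l => exists_eq_sum_tmul_tmul (k := k)
      ((TensorProduct.map (comul (R := k)) LinearMap.id) (comul (R := k) (p2 j l)))
    refine dual_tmul_ext fun x => ?_
    have hP : ∀ i j, mulD (SD (μ2 i ⊗ₜ[k] m1 j)) (μ1 i ⊗ₜ[k] m2 j) = ∑ l, ∑ n,
        dualMul ((μ2 i ∘ₗ Sinv) ∘ₗ (LinearMap.mulLeft k (p1 j l)) ∘ₗ
            (LinearMap.mulRight k (antipode k (p3 j l))))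
          (μ1 i ∘ₗ (LinearMap.mulLeft k (Sinv (antipode k (u j l n)))) ∘ₗ
            (LinearMap.mulRight k (antipode k (w j l n)))) ⊗ₜ[k]
          (antipode k (v j l n) * m2 j) := by
      intro i j
      rw [SD_def _ _ _ _ _ _ (hp j), map_sum, LinearMap.sum_apply]
      exact Finset.sum_congr rfl fun l _ =>
        mulD_def _ _ _ _ _ _ _ _ (comul_comul_antipode_eq_sum (hq j l))
    simp only [hP, map_sum, LinearMap.sum_apply, dualTensorHom_apply,
      dualMul_apply_eq_sum _ _ x (ℛ k x), Finset.sum_smul]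
    rw [sum_comm_dependent]
    trans ∑ r ∈ (ℛ k x).index, endEval μ (Sinv ((ℛ k x).left r))
      ((toConv (rightMulMap k B ∘ₗ Sinv) *
        toConv (LinearMap.mulRight k (leftMulAlgHom k B ((ℛ k x).right r)) ∘ₗ
        (leftMulAlgHom k B).toLinearMap)) m)
    · refine Finset.sum_congr rfl fun r _ => ?_
      rw [← conv_mul_antipode_cancel_left _ _ (leftMulAlgHom k B)
        (Algebra.TensorProduct.includeRight : B →ₐ[k] Module.End k B ⊗[k] B),
        conv_apply_of_comul_eq hm, map_sum]
      refine Finset.sum_congr rfl fun j _ => ?_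
      rw [conv_apply_of_comul_comul_eq (hp j), Finset.sum_mul, map_sum]
      refine Finset.sum_congr rfl fun l _ => ?_
      rw [conv_apply_of_comul_comul_eq (hq j l)]
      simp only [Finset.mul_sum, Finset.sum_mul, map_sum]
      refine Finset.sum_congr rfl fun n _ => ?_
      rw [← Finset.sum_smul]
      simp [rightMulMap, leftMulAlgHom, endEval_tmul, hr, hSm]
      congr 1
      rw [← mul_assoc (antipode k (w j l n)), ← mul_assoc ((ℛ k x).right r), ← mul_assoc,
        mul_assoc, ← mul_assoc ((ℛ k x).right r), ← mul_assoc (u j l n)]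
      simp only [mul_assoc]
      rw [show ∀ a b c d e f : B, a * (b * (c * (d * (e * f)))) = (a * (b * c)) * (d * (e * f)) by
        simp [mul_assoc], hμ]
      simp only [mul_comm]
    · simp only [conv_apply_of_comul_eq (ℛ k m).eq.symm, map_sum]
      rw [Finset.sum_comm]
      trans ∑ i ∈ (ℛ k m).index,
          (counit (R := k) x * μ ((ℛ k m).right i * Sinv ((ℛ k m).left i))) • (1 : B)
      · refine Finset.sum_congr rfl fun i _ => ?_
        have h := congrArg (fun c => μ ((ℛ k m).right i * c * Sinv ((ℛ k m).left i)))
          (sum_mul_inverse_antipode hl hr (ℛ k x))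
        simp only [Finset.mul_sum, Finset.sum_mul, map_sum, mul_smul_comm, smul_mul_assoc,
          map_smul, mul_one, smul_eq_mul] at h
        rw [← h, Finset.sum_smul]
        refine Finset.sum_congr rfl fun r _ => ?_
        simp [rightMulMap, leftMulAlgHom, endEval_tmul, mul_assoc]
      · rw [← Finset.sum_smul, ← Finset.mul_sum, ← map_sum, sum_mul_inverse_antipode hl hr]
        simp [smul_smul, mul_comm, mul_left_comm]
  · choose L p1 p2 p3 hp using fun j => exists_eq_sum_tmul_tmul (k := k)
      ((TensorProduct.map (comul (R := k)) LinearMap.id) (comul (R := k) (m1 j)))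
    choose K q1 q2 q3 hq using fun j => exists_eq_sum_tmul_tmul (k := k)
      ((TensorProduct.map (comul (R := k)) LinearMap.id) (comul (R := k) (m2 j)))
    refine dual_tmul_ext fun x => ?_
    have hP : ∀ i j, mulD (μ2 i ⊗ₜ[k] m1 j) (SD (μ1 i ⊗ₜ[k] m2 j)) = ∑ n, ∑ l,
        dualMul (μ2 i) (((μ1 i ∘ₗ Sinv) ∘ₗ (LinearMap.mulLeft k (q1 j n)) ∘ₗ
            (LinearMap.mulRight k (antipode k (q3 j n)))) ∘ₗ
            (LinearMap.mulLeft k (Sinv (p3 j l))) ∘ₗ (LinearMap.mulRight k (p1 j l))) ⊗ₜ[k]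
          (p2 j l * antipode k (q2 j n)) := by
      intro i j
      rw [SD_def _ _ _ _ _ _ (hq j), map_sum]
      exact Finset.sum_congr rfl fun n _ => mulD_def _ _ _ _ _ _ _ _ (hp j)
    simp only [hP, map_sum, LinearMap.sum_apply, dualTensorHom_apply,
      dualMul_apply_eq_sum _ _ x (ℛ k x), Finset.sum_smul]
    rw [sum_comm_dependent]
    trans ∑ r ∈ (ℛ k x).index, opEval Sinv μ ((ℛ k x).left r) ((ℛ k x).right r)
      ((1 : WithConv (B →ₗ[k] (Module.End k B)ᵐᵒᵖ ⊗[k] B)) m)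
    · refine Finset.sum_congr rfl fun r _ => ?_
      rw [← op_conv_eq_one hl hr, conv_apply_of_comul_eq hm, map_sum]
      refine Finset.sum_congr rfl fun j _ => ?_
      rw [conv_apply_of_comul_comul_eq (hp j), conv_apply_of_comul_comul_eq (hq j)]
      simp only [Finset.mul_sum, Finset.sum_mul, map_sum]
      refine Finset.sum_congr rfl fun n _ => Finset.sum_congr rfl fun l _ => ?_
      rw [← Finset.sum_smul]
      simp [opLeftMap, opRightMap, opEval_tmul]
      simp only [mul_assoc, hμ, mul_comm]
    · have h := congrArg μ (sum_inverse_antipode_mul hl hr (ℛ k x))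
      simp only [map_sum] at h
      simp [Algebra.algebraMap_eq_smul_one, Algebra.TensorProduct.one_def, opEval_tmul]
      rw [← Finset.smul_sum, ← Finset.sum_smul, h]
      simp [smul_smul, mul_comm, mul_left_comm]
end
end
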